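/- Let (G, Γ*) be a self-similar groupoid with associated inverse semigroup S_{(G,Γ*)} and semilattice of idempotents E_{(G,Γ*)}. Then E_{(G,Γ*)} is 0-disjunctive if and only if |s⁻¹(v)| ≠ 1 for all v ∈ Γ⁰. -/

import Mathlib

set_option autoImplicit false

/-! ## Directed graphs and path trees -/

/-- A row-finite directed graph. -/
structure DirGraph where
  V : Type
  E : Type
  src : E → V
  rng : E → V
  rowFinite : ∀ v : V, {e : E | src e = v}.Finite

/-- `Γ.IsPathFrom v l` : the list of edges `l` is a (finite) path with source `v`. -/
def DirGraph.IsPathFrom (Γ : DirGraph) : Γ.V → List Γ.E → Prop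
  | _, [] => True
  | v, e :: l => Γ.src e = v ∧ DirGraph.IsPathFrom Γ (Γ.rng e) l

/-- The range (terminal vertex) of a path with source `v` and edge list `l`. -/
def DirGraph.rng0 (Γ : DirGraph) : Γ.V → List Γ.E → Γ.V
  | v, [] => v
  | _, e :: l => DirGraph.rng0 Γ (Γ.rng e) l

/-- An isomorphism of rooted path trees `(dom)Γ* → (cod)Γ*`: a bijection between the
paths with source `dom` and the paths with source `cod` which fixes the root and maps
children to children (equivalently, a directed-graph isomorphism of the rooted trees). -/
structure Arrow (Γ : DirGraph) where
  dom : Γ.V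
  cod : Γ.V
  act : List Γ.E → List Γ.E
  inv : List Γ.E → List Γ.E
  act_maps : ∀ l, Γ.IsPathFrom dom l → Γ.IsPathFrom cod (act l)
  inv_maps : ∀ l, Γ.IsPathFrom cod l → Γ.IsPathFrom dom (inv l)
  left_inv : ∀ l, Γ.IsPathFrom dom l → inv (act l) = l
  right_inv : ∀ l, Γ.IsPathFrom cod l → act (inv l) = l
  act_nil : act [] = []
  act_snoc : ∀ l e, Γ.IsPathFrom dom (l ++ [e]) → ∃ e', act (l ++ [e]) = act l ++ [e']

/-- The identity tree isomorphism at a vertex `v`. -/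
def Arrow.idArrow (Γ : DirGraph) (v : Γ.V) : Arrow Γ where
  dom := v
  cod := v
  act := fun l => l
  inv := fun l => l
  act_maps := fun _ h => h
  inv_maps := fun _ h => h
  left_inv := fun _ _ => rfl
  right_inv := fun _ _ => rfl
  act_nil := rfl
  act_snoc := fun _ e _ => ⟨e, rfl⟩

namespace Arrow

variable {Γ : DirGraph}

/-- Two arrows represent the same tree isomorphism (they agree on all genuine paths). -/
def Same (g h : Arrow Γ) : Prop :=
  g.dom = h.dom ∧ g.cod = h.cod ∧ ∀ l, Γ.IsPathFrom g.dom l → g.act l = h.act l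

/-- `k` represents the identity isomorphism of `v Γ*`. -/
def IsIdArrow (v : Γ.V) (k : Arrow Γ) : Prop :=
  k.dom = v ∧ k.cod = v ∧ ∀ l, Γ.IsPathFrom v l → k.act l = l

/-- `k` represents the composition `g ∘ h` (first `h`, then `g`). -/
def IsComposition (g h k : Arrow Γ) : Prop :=
  h.cod = g.dom ∧ k.dom = h.dom ∧ k.cod = g.cod ∧
  ∀ l, Γ.IsPathFrom h.dom l → k.act l = g.act (h.act l)

/-- `k` represents the inverse isomorphism of `g`. -/
def IsInverseArrow (g k : Arrow Γ) : Prop :=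
  k.dom = g.cod ∧ k.cod = g.dom ∧ ∀ l, Γ.IsPathFrom g.dom l → k.act (g.act l) = l

/-- `h` represents the restriction `g|_p` of `g` to the path `p`, characterized by
`g(pq) = g(p)·h(q)` for all paths `q` with source `r(p)`. -/
def IsRestrictOf (g : Arrow Γ) (p : List Γ.E) (h : Arrow Γ) : Prop :=
  h.dom = Γ.rng0 g.dom p ∧ h.cod = Γ.rng0 g.cod (g.act p) ∧
  ∀ q, Γ.IsPathFrom (Γ.rng0 g.dom p) q → g.act (p ++ q) = g.act p ++ h.act q

end Arrow

/-! ## Self-similar groupoids -/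

/-- A self-similar groupoid `(G, Γ*)` : a set of tree isomorphisms (closed under
representing-the-same-isomorphism) which contains all the identities, is closed under
composition and inverses (a groupoid with object set `Γ⁰` acting faithfully on `Γ*`),
and is closed under restriction: for every `g ∈ G` and edge `e` in the domain of `g`
there is `g|_e ∈ G` with `g(ep) = g(e)·g|_e(p)`. -/
structure SSG (Γ : DirGraph) where
  carrier : Set (Arrow Γ)
  satur : ∀ g g', g ∈ carrier → g.Same g' → g' ∈ carrier
  id_mem : ∀ v, Arrow.idArrow Γ v ∈ carrier
  comp_mem : ∀ g h k, g ∈ carrier → h ∈ carrier → Arrow.IsComposition g h k → k ∈ carrier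
  inv_mem : ∀ g k, g ∈ carrier → Arrow.IsInverseArrow g k → k ∈ carrier
  restrict_mem : ∀ g ∈ carrier, ∀ e : Γ.E, Γ.src e = g.dom →
    ∃ h ∈ carrier, g.IsRestrictOf [e] h

/-- The condition: for each pair of distinct vertices `v, w` there exist paths
`p ∈ wΓ*` and `q ∈ vΓ*` such that `G` intersects `Iso(r(p), v)` and `Iso(r(q), w)`. -/
def OrbitCond (Γ : DirGraph) (Gs : SSG Γ) : Prop :=
  ∀ v w : Γ.V, v ≠ w →
    (∃ p, Γ.IsPathFrom w p ∧ ∃ g ∈ Gs.carrier, g.dom = Γ.rng0 w p ∧ g.cod = v) ∧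
    (∃ q, Γ.IsPathFrom v q ∧ ∃ g ∈ Gs.carrier, g.dom = Γ.rng0 v q ∧ g.cod = w)

/-- Type (CF): every vertex emits more than one edge, and the orbit condition holds. -/
def TypeCF (Γ : DirGraph) (Gs : SSG Γ) : Prop :=
  (∀ v : Γ.V, ∃ e f : Γ.E, e ≠ f ∧ Γ.src e = v ∧ Γ.src f = v) ∧ OrbitCond Γ Gs

/-! ## Contracting self-similar groupoids, nuclei, recurrent subgroups -/

/-- Every element of `G` eventually restricts into `A`. -/
def ContractsInto {Γ : DirGraph} (Gs : SSG Γ) (A : Set (Arrow Γ)) : Prop :=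
  ∀ g ∈ Gs.carrier, ∃ n : ℕ, ∀ l, Γ.IsPathFrom g.dom l → l.length = n →
    ∃ h ∈ A, g.IsRestrictOf l h

/-- A set of arrows covering only finitely many tree isomorphisms. -/
def FinUpToSame {Γ : DirGraph} (A : Set (Arrow Γ)) : Prop :=
  ∃ B : Finset (Arrow Γ), ∀ g ∈ A, ∃ h ∈ B, g.Same h

/-- `(G, Γ*)` is contracting. -/
def IsContracting {Γ : DirGraph} (Gs : SSG Γ) : Prop :=
  ∃ A : Set (Arrow Γ), A ⊆ Gs.carrier ∧ FinUpToSame A ∧ ContractsInto Gs A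

/-- `N` is the nucleus of `(G, Γ*)` : a minimal finite subset of `G` into which every
element of `G` eventually restricts. -/
def IsNucleus {Γ : DirGraph} (Gs : SSG Γ) (N : Set (Arrow Γ)) : Prop :=
  N ⊆ Gs.carrier ∧ FinUpToSame N ∧ ContractsInto Gs N ∧
  ∀ A : Set (Arrow Γ), A ⊆ Gs.carrier → FinUpToSame A → ContractsInto Gs A →
    ∀ g ∈ N, ∃ h ∈ A, g.Same h

/-- The recurrent set `H_p = {g ∈ G : g(p) = p, g|_p = g}` for a path `p ∈ vΓ*`. -/
def Hp {Γ : DirGraph} (Gs : SSG Γ) (v : Γ.V) (p : List Γ.E) : Set (Arrow Γ) :=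
  {g | g ∈ Gs.carrier ∧ g.dom = v ∧ g.cod = v ∧ g.act p = p ∧ g.IsRestrictOf p g}

/-! ## The associated inverse semigroup `S_{(G,Γ*)}` -/

/-- The product in `S` of a path: `p = e₁ e₂ ⋯ eₙ · r(p)` (just `v` for the empty path). -/
def pathProd {Γ : DirGraph} {S : Type} (mul : S → S → S) (ιV : Γ.V → S) (ιE : Γ.E → S)
    (v : Γ.V) (p : List Γ.E) : S :=
  p.foldr (fun e a => mul (ιE e) a) (ιV (Γ.rng0 v p))

/-- The inverse semigroup with zero `S_{(G,Γ*)}` associated to a self-similar groupoid,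
presented through its characterizing properties: it is an inverse semigroup with zero,
generated by `Γ⁰ ∪ Γ¹ ∪ Γ⁻¹ ∪ G` subject to the defining relations, in which every
nonzero element has a unique canonical form `p g q*`. -/
structure AssocISG (Γ : DirGraph) (Gs : SSG Γ) where
  S : Type
  mul : S → S → S
  zero : S
  star : S → S
  mul_assoc : ∀ a b c, mul (mul a b) c = mul a (mul b c)
  zero_mul : ∀ a, mul zero a = zero
  mul_zero : ∀ a, mul a zero = zero
  inv_ax : ∀ a, mul (mul a (star a)) a = a ∧ mul (mul (star a) a) (star a) = star a
  inv_unique : ∀ a b, mul (mul a b) a = a → mul (mul b a) b = b → b = star a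
  ιV : Γ.V → S
  ιE : Γ.E → S
  ιG : Arrow Γ → S
  ιG_same : ∀ g h, g.Same h → ιG g = ιG h
  rel_src : ∀ e, mul (ιV (Γ.src e)) (ιE e) = ιE e
  rel_rng : ∀ e, mul (ιE e) (ιV (Γ.rng e)) = ιE e
  rel_vv : ∀ u v, u ≠ v → mul (ιV u) (ιV v) = zero
  rel_v_idem : ∀ v, mul (ιV v) (ιV v) = ιV v
  rel_star_v : ∀ v, star (ιV v) = ιV v
  rel_ef : ∀ e f, e ≠ f → mul (star (ιE e)) (ιE f) = zero
  rel_ee : ∀ e, mul (star (ιE e)) (ιE e) = ιV (Γ.rng e)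
  rel_comp : ∀ g h k, g ∈ Gs.carrier → h ∈ Gs.carrier → Arrow.IsComposition g h k →
    mul (ιG g) (ιG h) = ιG k
  rel_notcomp : ∀ g h, g ∈ Gs.carrier → h ∈ Gs.carrier → h.cod ≠ g.dom →
    mul (ιG g) (ιG h) = zero
  rel_star : ∀ g k, g ∈ Gs.carrier → Arrow.IsInverseArrow g k → star (ιG g) = ιG k
  rel_id : ∀ v, ιG (Arrow.idArrow Γ v) = ιV v
  rel_ge : ∀ g ∈ Gs.carrier, ∀ (e e' : Γ.E) (h : Arrow Γ), Γ.src e = g.dom →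
    g.act [e] = [e'] → g.IsRestrictOf [e] h → mul (ιG g) (ιE e) = mul (ιE e') (ιG h)
  canon_ex : ∀ s, s ≠ zero → ∃ (v w : Γ.V) (p q : List Γ.E) (g : Arrow Γ),
    Γ.IsPathFrom v p ∧ Γ.IsPathFrom w q ∧ g ∈ Gs.carrier ∧
    g.dom = Γ.rng0 w q ∧ g.cod = Γ.rng0 v p ∧
    s = mul (mul (pathProd mul ιV ιE v p) (ιG g)) (star (pathProd mul ιV ιE w q))
  canon_nonzero : ∀ (v w : Γ.V) (p q : List Γ.E) (g : Arrow Γ),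
    Γ.IsPathFrom v p → Γ.IsPathFrom w q → g ∈ Gs.carrier →
    g.dom = Γ.rng0 w q → g.cod = Γ.rng0 v p →
    mul (mul (pathProd mul ιV ιE v p) (ιG g)) (star (pathProd mul ιV ιE w q)) ≠ zero
  canon_inj : ∀ (v w v' w' : Γ.V) (p q p' q' : List Γ.E) (g g' : Arrow Γ),
    Γ.IsPathFrom v p → Γ.IsPathFrom w q → g ∈ Gs.carrier →
    g.dom = Γ.rng0 w q → g.cod = Γ.rng0 v p →
    Γ.IsPathFrom v' p' → Γ.IsPathFrom w' q' → g' ∈ Gs.carrier →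
    g'.dom = Γ.rng0 w' q' → g'.cod = Γ.rng0 v' p' →
    mul (mul (pathProd mul ιV ιE v p) (ιG g)) (star (pathProd mul ιV ιE w q)) =
      mul (mul (pathProd mul ιV ιE v' p') (ιG g')) (star (pathProd mul ιV ιE w' q')) →
    v = v' ∧ w = w' ∧ p = p' ∧ q = q' ∧ g.Same g'

namespace AssocISG

variable {Γ : DirGraph} {Gs : SSG Γ}

/-- The element of `S` represented by a path. -/
def P (T : AssocISG Γ Gs) (v : Γ.V) (p : List Γ.E) : T.S :=
  pathProd T.mul T.ιV T.ιE v p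

def IsIdem (T : AssocISG Γ Gs) (e : T.S) : Prop := T.mul e e = e

/-- The natural partial order on idempotents: `f ≤ e` iff `f = g e` for an idempotent `g`. -/
def idemLe (T : AssocISG Γ Gs) (f e : T.S) : Prop := ∃ g, T.IsIdem g ∧ f = T.mul g e

/-- A congruence on `S`. -/
def IsCongruence (T : AssocISG Γ Gs) (r : T.S → T.S → Prop) : Prop :=
  Equivalence r ∧ ∀ a b c, r a b → r (T.mul c a) (T.mul c b) ∧ r (T.mul a c) (T.mul b c)

/-- `S` is congruence-free: its only congruences are equality and the universal relation. -/
def CongruenceFree (T : AssocISG Γ Gs) : Prop :=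
  ∀ r, T.IsCongruence r → (∀ a b, r a b ↔ a = b) ∨ (∀ a b, r a b)

/-- `S` is fundamental. -/
def Fundamental (T : AssocISG Γ Gs) : Prop :=
  ∀ a b : T.S,
    (∀ e, T.IsIdem e → T.mul (T.mul a e) (T.star a) = T.mul (T.mul b e) (T.star b)) → a = b

/-- `S` is 0-simple: its only (two-sided semigroup) ideals are `{0}` and `S`. -/
def ZeroSimple (T : AssocISG Γ Gs) : Prop :=
  ∀ J : Set T.S, J.Nonempty → (∀ s x, x ∈ J → T.mul s x ∈ J ∧ T.mul x s ∈ J) →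
    J = {T.zero} ∨ J = Set.univ

/-- The semilattice of idempotents of `S` is 0-disjunctive. -/
def ZeroDisjunctive (T : AssocISG Γ Gs) : Prop :=
  ∀ e f, T.IsIdem e → T.IsIdem f → e ≠ T.zero → f ≠ T.zero → e ≠ f →
    ∃ h, T.IsIdem h ∧ Xor' (T.mul e h = T.zero) (T.mul f h = T.zero)

end AssocISG

/-! ## The contracted inverse semigroup algebra `K S_{(G,Γ*)}` -/

/-- The contracted inverse semigroup algebra of `S_{(G,Γ*)}` over a field `K` :
a (possibly nonunital) `K`-algebra with basis `S ∖ {0}` and multiplication extending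
that of `S` (identifying the zeros of `S` and `K`). -/
structure ContractedAlg (K : Type) [Field K] {Γ : DirGraph} {Gs : SSG Γ}
    (T : AssocISG Γ Gs) where
  A : Type
  [ringA : NonUnitalRing A]
  [modA : Module K A]
  smul_mul : ∀ (k : K) (a b : A), (k • a) * b = k • (a * b)
  mul_smul_comm : ∀ (k : K) (a b : A), a * (k • b) = k • (a * b)
  δ : T.S → A
  δ_zero : δ T.zero = 0
  δ_mul : ∀ s t, δ (T.mul s t) = δ s * δ t
  indep : LinearIndependent K (fun s : {s : T.S // s ≠ T.zero} => δ s.1)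
  spans : ∀ a : A, a ∈ Submodule.span K (Set.range (fun s : {s : T.S // s ≠ T.zero} => δ s.1))

attribute [instance] ContractedAlg.ringA ContractedAlg.modA

/-- Product of a list in a (nonunital) ring, with the empty product read as `0`. -/
def listProd {A : Type} [Mul A] [Zero A] : List A → A
  | [] => 0
  | a :: l => l.foldl (· * ·) a

namespace ContractedAlg

variable {K : Type} [Field K] {Γ : DirGraph} {Gs : SSG Γ} {T : AssocISG Γ Gs}

/-- A (two-sided, `K`-linear) ideal of the algebra, as a set. -/
def IsIdealSet (C : ContractedAlg K T) (J : Set C.A) : Prop :=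
  (0 : C.A) ∈ J ∧ (∀ x y, x ∈ J → y ∈ J → x + y ∈ J) ∧ (∀ x, x ∈ J → -x ∈ J) ∧
  (∀ (k : K) x, x ∈ J → k • x ∈ J) ∧
  (∀ x y, x ∈ J → y * x ∈ J) ∧ (∀ x y, x ∈ J → x * y ∈ J)

/-- The ideal generated by a set. -/
def idealGen (C : ContractedAlg K T) (X : Set C.A) : Set C.A :=
  ⋂₀ {J | C.IsIdealSet J ∧ X ⊆ J}

/-- The generators `∏_{f ∈ F} (e - f)` of the tight ideal, for `e` a nonzero idempotent
and `F` a finite cover of `e`. -/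
def tightGens (C : ContractedAlg K T) : Set C.A :=
  {x | ∃ (e : T.S) (l : List T.S), T.IsIdem e ∧ e ≠ T.zero ∧ l ≠ [] ∧
    (∀ f ∈ l, T.IsIdem f ∧ T.idemLe f e) ∧
    (∀ g, T.IsIdem g → g ≠ T.zero → T.idemLe g e → ∃ f ∈ l, T.mul g f ≠ T.zero) ∧
    x = listProd (l.map fun f => C.δ e - C.δ f)}

/-- The tight ideal of `K S_{(G,Γ*)}`. -/
def Itight (C : ContractedAlg K T) : Set C.A := C.idealGen C.tightGens

/-- The Cuntz–Krieger generators `v - ∑_{e ∈ vΓ¹} e e*`. -/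
def ckGens (C : ContractedAlg K T) : Set C.A :=
  {x | ∃ v : Γ.V,
    x = C.δ (T.ιV v) -
      ∑ e ∈ (Γ.rowFinite v).toFinset, C.δ (T.mul (T.ιE e) (T.star (T.ιE e)))}

/-- The Cuntz–Krieger ideal of `K S_{(G,Γ*)}`. -/
def Ick (C : ContractedAlg K T) : Set C.A := C.idealGen C.ckGens

/-- An element `a` is singular: for every nonzero idempotent `e` there is a nonzero
idempotent `f ≤ e` with `a f = 0`. -/
def IsSingular (C : ContractedAlg K T) (a : C.A) : Prop :=
  ∀ e, T.IsIdem e → e ≠ T.zero →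
    ∃ f, T.IsIdem f ∧ f ≠ T.zero ∧ T.idemLe f e ∧ a * C.δ f = 0

/-- The essential (singular) ideal of `K S_{(G,Γ*)}`. -/
def Iess (C : ContractedAlg K T) : Set C.A := {a | C.IsSingular a}

/-- The quotient of the algebra by the ideal `I` is simple. -/
def QuotSimple (C : ContractedAlg K T) (I : Set C.A) : Prop :=
  I ≠ Set.univ ∧ ∀ J, C.IsIdealSet J → I ⊆ J → J = I ∨ J = Set.univ

end ContractedAlg
/-! ## Collapsing self-similar groupoids -/

/-- A morphism of directed graphs. -/
structure GraphHom (Γ Λ : DirGraph) where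
  vmap : Γ.V → Λ.V
  emap : Γ.E → Λ.E
  hsrc : ∀ e, Λ.src (emap e) = vmap (Γ.src e)
  hrng : ∀ e, Λ.rng (emap e) = vmap (Γ.rng e)

/-- The induced map on paths. -/
def GraphHom.pmap {Γ Λ : DirGraph} (β : GraphHom Γ Λ) (l : List Γ.E) : List Λ.E :=
  l.map β.emap

/-- `F` is a system of collapsing isomorphisms for `(G, Γ*)` : a wide subgroupoid of `G`
containing all identities, with at most one arrow between any two objects, and with an
arrow `u → v` whenever `G` has one (as produced by choosing orbit representatives `R`
and isomorphisms `f_u` with `id_u = f_u⁻¹ id_v f_u`). -/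
def IsFsystem {Γ : DirGraph} (Gs : SSG Γ) (F : Set (Arrow Γ)) : Prop :=
  F ⊆ Gs.carrier ∧
  (∀ g g', g ∈ F → g.Same g' → g' ∈ F) ∧
  (∀ v, Arrow.idArrow Γ v ∈ F) ∧
  (∀ g h k, g ∈ F → h ∈ F → Arrow.IsComposition g h k → k ∈ F) ∧
  (∀ g k, g ∈ F → Arrow.IsInverseArrow g k → k ∈ F) ∧
  (∀ g g', g ∈ F → g' ∈ F → g.dom = g'.dom → g.cod = g'.cod → g.Same g') ∧
  (∀ g ∈ Gs.carrier, ∃ f ∈ F, f.dom = g.dom ∧ f.cod = g.cod)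

/-- `β : Γ → Λ` is the quotient graph morphism determined by `F` : it is surjective and
locally bijective, its vertex fibres are exactly the `F`-orbits of vertices, and it is
invariant under the action of `F` on paths (so that the fibres on paths are exactly the
`∼_F`-classes). -/
def IsCollapse {Γ Λ : DirGraph} (Gs : SSG Γ) (F : Set (Arrow Γ)) (β : GraphHom Γ Λ) : Prop :=
  Function.Surjective β.vmap ∧
  (∀ v : Γ.V, Set.BijOn β.emap {e | Γ.src e = v} {e' | Λ.src e' = β.vmap v}) ∧
  (∀ u v : Γ.V, β.vmap u = β.vmap v ↔ ∃ f ∈ F, f.dom = u ∧ f.cod = v) ∧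
  (∀ f ∈ F, ∀ l, Γ.IsPathFrom f.dom l → β.pmap (f.act l) = β.pmap l)

/-- `m` is the tree isomorphism of `Λ*` induced by `g` under the identification `β`
(the image `α(g)` of `g` in the collapsed groupoid). -/
def IsPushArrow {Γ Λ : DirGraph} (β : GraphHom Γ Λ) (g : Arrow Γ) (m : Arrow Λ) : Prop :=
  m.dom = β.vmap g.dom ∧ m.cod = β.vmap g.cod ∧
  ∀ l, Γ.IsPathFrom g.dom l → m.act (β.pmap l) = β.pmap (g.act l)

/-- The collapsed groupoid `L = α(G)`, acting on `Λ*`. -/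
def Lcarrier {Γ Λ : DirGraph} (Gs : SSG Γ) (β : GraphHom Γ Λ) : Set (Arrow Λ) :=
  {m | ∃ g ∈ Gs.carrier, IsPushArrow β g m}

/-! ## The graph Δ : cycles of the Moore diagram, the sets `I_q`, synchronization -/

/-- Membership in `N` up to representing the same tree isomorphism. -/
def memSame {Γ : DirGraph} (N : Set (Arrow Γ)) (g : Arrow Γ) : Prop :=
  ∃ h ∈ N, g.Same h

/-- The set `C` of elements of the nucleus `N` lying on a nonempty cycle of the subgraph
`H` of the Moore diagram of `N` consisting of the edges labelled `(e, e)` : `g ∈ C` iff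
`g ∈ N` and there is a nonempty path `p` with `g(p) = p`, `g|_p = g`, and all the
intermediate restrictions `g|_{p'}` (for prefixes `p'` of `p`) in `N`. -/
def Cset {Γ : DirGraph} (N : Set (Arrow Γ)) : Set (Arrow Γ) :=
  {g | memSame N g ∧ ∃ p : List Γ.E, p ≠ [] ∧ Γ.IsPathFrom g.dom p ∧ g.act p = p ∧
    g.IsRestrictOf p g ∧
    ∀ l₁ l₂ : List Γ.E, p = l₁ ++ l₂ → ∃ h, memSame N h ∧ g.IsRestrictOf l₁ h}

/-- The vertex `I_q = q · {id_{r(q)}} = {g ∈ C : g(q) = q, g|_q = id}` of `Δ`,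
for a path `q ∈ vΓ*`. -/
def Iq {Γ : DirGraph} (N : Set (Arrow Γ)) (v : Γ.V) (q : List Γ.E) : Set (Arrow Γ) :=
  {g | g ∈ Cset N ∧ g.dom = v ∧ g.cod = v ∧
    ∀ w, Γ.IsPathFrom (Γ.rng0 v q) w → g.act (q ++ w) = q ++ w}

/-- The path `p ∈ vΓ*` is synchronizing in `Δ` : every path of `Δ` labelled by the
reversal of `p` ends at the same vertex, i.e. `I_{pq} = I_{pq'}` for all `q, q' ∈ r(p)Γ*`. -/
def Synchronizing {Γ : DirGraph} (N : Set (Arrow Γ)) (v : Γ.V) (p : List Γ.E) : Prop :=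
  Γ.IsPathFrom v p ∧
  ∀ q q', Γ.IsPathFrom (Γ.rng0 v p) q → Γ.IsPathFrom (Γ.rng0 v p) q' →
    Iq N v (p ++ q) = Iq N v (p ++ q')

/-- A vertex `X` of `Δ` is synchronized: `X = I_w` for some synchronizing path `w`. -/
def SyncVertex {Γ : DirGraph} (N : Set (Arrow Γ)) (X : Set (Arrow Γ)) : Prop :=
  ∃ v p, Synchronizing N v p ∧ X = Iq N v p

/-- The vertex set `Q = {I_q : q ∈ Γ*}` of the Schreier graph `Δ`. -/
def Qset {Γ : DirGraph} (N : Set (Arrow Γ)) : Set (Set (Arrow Γ)) :=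
  {X | ∃ v q, Γ.IsPathFrom v q ∧ X = Iq N v q}

/-- The edge relation of `Δ` : an edge labelled `e` from `I_q` to `I_{eq}`. -/
def DeltaStep {Γ : DirGraph} (N : Set (Arrow Γ)) (X Y : Set (Arrow Γ)) : Prop :=
  ∃ v q e, Γ.IsPathFrom v q ∧ Γ.rng e = v ∧ X = Iq N v q ∧ Y = Iq N (Γ.src e) (e :: q)

/-- Reachability in `Δ`. -/
def DeltaReaches {Γ : DirGraph} (N : Set (Arrow Γ)) : Set (Arrow Γ) → Set (Arrow Γ) → Prop :=
  Relation.ReflTransGen (DeltaStep N)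

/-- A vertex of `Δ` lying in a minimal strongly connected component with respect to
reachability. -/
def DeltaMinVert {Γ : DirGraph} (N : Set (Arrow Γ)) (X : Set (Arrow Γ)) : Prop :=
  X ∈ Qset N ∧ ∀ Y ∈ Qset N, DeltaReaches N X Y → DeltaReaches N Y X

/- `π_{p,q}(a) = 0` for `a = ∑_{g ∈ Tset} c_g · g ∈ K H_p`, where
`π_{p,q} : K H_p → K[H_p / (H_p ∩ I_q)]` is induced by the canonical map of `H_p` onto
the left cosets of `H_p ∩ I_q` : the sum of the coefficients over each left coset of
`H_p ∩ I_q` vanishes. -/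
open Classical in
def PiZero (K : Type) [Field K] {Γ : DirGraph} (Gs : SSG Γ) (N : Set (Arrow Γ))
    (v : Γ.V) (p q : List Γ.E) (Tset : Finset (Arrow Γ)) (c : Arrow Γ → K) : Prop :=
  ∀ g₀ ∈ Hp Gs v p,
    (∑ h ∈ Tset,
      if ∃ k, k ∈ Hp Gs v p ∧ k ∈ Iq N v q ∧ Arrow.IsComposition g₀ k h then c h else 0) = 0

/-! ## STATEMENT 4 -/

/-! ## Semigroups with unique inverses -/

section UniqueInverses

variable {S : Type*} [Semigroup S] {inv : S → S}

/-- In a semigroup with unique inverses, a product of two idempotents is idempotent. -/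
theorem IsIdempotentElem.mul_of_unique_inverses
    (hinv : ∀ a, a * inv a * a = a ∧ inv a * a * inv a = inv a)
    (huniq : ∀ a b, a * b * a = a → b * a * b = b → b = inv a)
    {e f : S} (he : IsIdempotentElem e) (hf : IsIdempotentElem f) :
    IsIdempotentElem (e * f) := by
  have he' : ∀ x, e * (e * x) = e * x := fun x => by rw [← mul_assoc, he.eq]
  have hf' : ∀ x, f * (f * x) = f * x := fun x => by rw [← mul_assoc, hf.eq]
  obtain ⟨h₁, h₂⟩ := hinv (e * f)
  set x := inv (e * f) with hx
  have h₃ : f * x * e = x := by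
    refine huniq (e * f) _ ?_ ?_
    · simpa only [mul_assoc, he', hf'] using h₁
    · have := congrArg (fun y => f * y * e) h₂
      simpa only [mul_assoc, he', hf'] using this
  have hxx : x * x = x := by
    have := congrArg (fun y => f * y * e) h₂
    calc x * x = (f * x * e) * (f * x * e) := by rw [h₃]
      _ = f * x * e := by simpa only [mul_assoc] using this
      _ = x := h₃
  have hself : x = inv x := huniq x x (by rw [hxx, hxx]) (by rw [hxx, hxx])
  have hef : e * f = inv x := huniq x _ h₂ h₁
  rw [hef, ← hself]
  exact hxx

/-- In a semigroup with unique inverses, idempotents commute. -/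
theorem IsIdempotentElem.commute_of_unique_inverses
    (hinv : ∀ a, a * inv a * a = a ∧ inv a * a * inv a = inv a)
    (huniq : ∀ a b, a * b * a = a → b * a * b = b → b = inv a)
    {e f : S} (he : IsIdempotentElem e) (hf : IsIdempotentElem f) :
    e * f = f * e := by
  have he' : ∀ x, e * (e * x) = e * x := fun x => by rw [← mul_assoc, he.eq]
  have hf' : ∀ x, f * (f * x) = f * x := fun x => by rw [← mul_assoc, hf.eq]
  have h₁ := (he.mul_of_unique_inverses hinv huniq hf).eq
  have h₂ := (hf.mul_of_unique_inverses hinv huniq he).eq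
  have h₃ : e * f = inv (e * f) := huniq _ _ (by rw [h₁, h₁]) (by rw [h₁, h₁])
  have h₄ : f * e = inv (e * f) := by
    refine huniq _ _ ?_ ?_
    · simpa only [mul_assoc, he', hf'] using h₁
    · simpa only [mul_assoc, he', hf'] using h₂
  rw [h₃, ← h₄]

/-- In a semigroup with unique inverses, inversion is anti-multiplicative. -/
theorem inverse_mul_of_unique_inverses
    (hinv : ∀ a, a * inv a * a = a ∧ inv a * a * inv a = inv a)
    (huniq : ∀ a b, a * b * a = a → b * a * b = b → b = inv a) (a b : S) :
    inv (a * b) = inv b * inv a := by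
  have ha : IsIdempotentElem (inv a * a) := by
    rw [IsIdempotentElem, ← mul_assoc, (hinv a).2]
  have hb : IsIdempotentElem (b * inv b) := by
    rw [IsIdempotentElem, ← mul_assoc, (hinv b).1]
  have hc := ha.commute_of_unique_inverses hinv huniq hb
  refine (huniq _ _ ?_ ?_).symm
  · calc a * b * (inv b * inv a) * (a * b)
        = a * ((b * inv b) * (inv a * a)) * b := by simp only [mul_assoc]
      _ = (a * inv a * a) * (b * inv b * b) := by rw [← hc]; simp only [mul_assoc]
      _ = a * b := by rw [(hinv a).1, (hinv b).1]
  · calc inv b * inv a * (a * b) * (inv b * inv a)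
        = inv b * ((inv a * a) * (b * inv b)) * inv a := by simp only [mul_assoc]
      _ = (inv b * b * inv b) * (inv a * a * inv a) := by rw [hc]; simp only [mul_assoc]
      _ = inv b * inv a := by rw [(hinv a).2, (hinv b).2]

end UniqueInverses

/-! ## Paths and inverse arrows -/

namespace DirGraph

variable {Γ : DirGraph}

theorem isPathFrom_append {v : Γ.V} {p q : List Γ.E} :
    Γ.IsPathFrom v (p ++ q) ↔ Γ.IsPathFrom v p ∧ Γ.IsPathFrom (Γ.rng0 v p) q := by
  induction p generalizing v with
  | nil => simp [IsPathFrom, rng0]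
  | cons e p ih => simp [IsPathFrom, rng0, ih, and_assoc]

end DirGraph

/-- The inverse of a tree isomorphism. -/
def Arrow.symm {Γ : DirGraph} (g : Arrow Γ) : Arrow Γ where
  dom := g.cod
  cod := g.dom
  act := g.inv
  inv := g.act
  act_maps := g.inv_maps
  inv_maps := g.act_maps
  left_inv := g.right_inv
  right_inv := g.left_inv
  act_nil := by simpa [g.act_nil] using g.left_inv [] trivial
  act_snoc := by
    intro l e h
    have hm := g.inv_maps _ h
    have hr := g.right_inv _ h
    rcases List.eq_nil_or_concat (g.inv (l ++ [e])) with h0 | ⟨m, x, hx⟩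
    · rw [h0, g.act_nil] at hr
      simp at hr
    · rw [List.concat_eq_append] at hx
      rw [hx] at hm hr
      obtain ⟨y, hy⟩ := g.act_snoc m x hm
      rw [hy] at hr
      have hl : g.act m = l := (List.append_inj' hr rfl).1
      refine ⟨x, ?_⟩
      rw [hx, ← hl, g.left_inv m (DirGraph.isPathFrom_append.1 hm).1]

theorem Arrow.isInverseArrow_symm {Γ : DirGraph} (g : Arrow Γ) :
    g.IsInverseArrow g.symm :=
  ⟨rfl, rfl, g.left_inv⟩

theorem Arrow.isComposition_symm {Γ : DirGraph} (g : Arrow Γ) :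
    g.IsComposition g.symm (Arrow.idArrow Γ g.cod) :=
  ⟨rfl, rfl, rfl, fun l hl => (g.right_inv l hl).symm⟩

/-! ## Idempotents of the associated inverse semigroup -/

namespace AssocISG

variable {Γ : DirGraph} {Gs : SSG Γ} (T : AssocISG Γ Gs)

theorem star_mul (a b : T.S) : T.star (T.mul a b) = T.mul (T.star b) (T.star a) :=
  letI : Semigroup T.S := { mul := T.mul, mul_assoc := T.mul_assoc }
  inverse_mul_of_unique_inverses (S := T.S) T.inv_ax T.inv_unique a b

theorem star_star (a : T.S) : T.star (T.star a) = a :=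
  (T.inv_unique _ _ (T.inv_ax a).2 (T.inv_ax a).1).symm

variable {T} in
theorem IsIdem.star_eq {e : T.S} (he : T.IsIdem e) : T.star e = e := by
  have he' : T.mul e e = e := he
  exact (T.inv_unique e e (by rw [he', he']) (by rw [he', he'])).symm

theorem P_nil (v : Γ.V) : T.P v [] = T.ιV v := rfl

theorem P_cons (v : Γ.V) (e : Γ.E) (p : List Γ.E) :
    T.P v (e :: p) = T.mul (T.ιE e) (T.P (Γ.rng e) p) := rfl

theorem ιV_mul_P {v : Γ.V} {p : List Γ.E} (hp : Γ.IsPathFrom v p) :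
    T.mul (T.ιV v) (T.P v p) = T.P v p := by
  cases p with
  | nil => exact T.rel_v_idem v
  | cons e p =>
    obtain ⟨rfl, -⟩ := hp
    rw [P_cons, ← T.mul_assoc, T.rel_src]

theorem P_mul_ιV (v : Γ.V) (p : List Γ.E) :
    T.mul (T.P v p) (T.ιV (Γ.rng0 v p)) = T.P v p := by
  induction p generalizing v with
  | nil => exact T.rel_v_idem v
  | cons e p ih => rw [P_cons, T.mul_assoc, DirGraph.rng0, ih]

theorem P_append {v : Γ.V} {p q : List Γ.E} (hpq : Γ.IsPathFrom v (p ++ q)) :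
    T.P v (p ++ q) = T.mul (T.P v p) (T.P (Γ.rng0 v p) q) := by
  induction p generalizing v with
  | nil => exact (T.ιV_mul_P hpq).symm
  | cons e p ih => rw [List.cons_append, P_cons, P_cons, T.mul_assoc, ih hpq.2, DirGraph.rng0]

theorem star_P_mul_P {v : Γ.V} {p : List Γ.E} (hp : Γ.IsPathFrom v p) :
    T.mul (T.star (T.P v p)) (T.P v p) = T.ιV (Γ.rng0 v p) := by
  induction p generalizing v with
  | nil => rw [P_nil, T.rel_star_v, T.rel_v_idem]; rfl
  | cons e p ih =>
    rw [P_cons, T.star_mul, T.mul_assoc, ← T.mul_assoc _ (T.ιE e), T.rel_ee, T.ιV_mul_P hp.2,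
      ih hp.2, DirGraph.rng0]

theorem ιV_mul_P_of_ne {u v : Γ.V} (huv : u ≠ v) {p : List Γ.E} (hp : Γ.IsPathFrom v p) :
    T.mul (T.ιV u) (T.P v p) = T.zero := by
  rw [← T.ιV_mul_P hp, ← T.mul_assoc, T.rel_vv u v huv, T.zero_mul]

/-- Paths none of which extends the other are orthogonal. -/
theorem star_P_mul_P_of_incomparable {v w : Γ.V} {p q : List Γ.E}
    (hp : Γ.IsPathFrom v p) (hq : Γ.IsPathFrom w q)
    (h : ¬ (v = w ∧ (p <+: q ∨ q <+: p))) :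
    T.mul (T.star (T.P v p)) (T.P w q) = T.zero := by
  by_cases hvw : v = w
  · subst hvw
    induction p generalizing v q with
    | nil => simp at h
    | cons e p ih =>
      cases q with
      | nil => simp at h
      | cons f q =>
        rw [P_cons, P_cons, T.star_mul, T.mul_assoc, ← T.mul_assoc _ (T.ιE f)]
        by_cases hef : e = f
        · subst hef
          rw [T.rel_ee, T.ιV_mul_P hq.2]
          exact ih hp.2 hq.2 (by simpa [List.cons_prefix_cons] using h)
        · rw [T.rel_ef e f hef, T.zero_mul, T.mul_zero]
  · rw [← T.ιV_mul_P hp, T.star_mul, T.rel_star_v, T.mul_assoc, T.ιV_mul_P_of_ne hvw hq,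
      T.mul_zero]

/-- The idempotent `pp*` of a path `p`. -/
def pathIdem (v : Γ.V) (p : List Γ.E) : T.S := T.mul (T.P v p) (T.star (T.P v p))

theorem isIdem_pathIdem (v : Γ.V) (p : List Γ.E) : T.IsIdem (T.pathIdem v p) := by
  rw [IsIdem, pathIdem, ← T.mul_assoc, (T.inv_ax _).1]

theorem pathIdem_eq_canonical (v : Γ.V) (p : List Γ.E) :
    T.pathIdem v p =
      T.mul (T.mul (T.P v p) (T.ιG (Arrow.idArrow Γ (Γ.rng0 v p)))) (T.star (T.P v p)) := by
  rw [T.rel_id, T.P_mul_ιV, pathIdem]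

theorem pathIdem_ne_zero {v : Γ.V} {p : List Γ.E} (hp : Γ.IsPathFrom v p) :
    T.pathIdem v p ≠ T.zero := by
  rw [pathIdem_eq_canonical]
  exact T.canon_nonzero v v p p _ hp hp (Gs.id_mem _) rfl rfl

theorem pathIdem_inj {v w : Γ.V} {p q : List Γ.E} (hp : Γ.IsPathFrom v p)
    (hq : Γ.IsPathFrom w q) (h : T.pathIdem v p = T.pathIdem w q) : v = w ∧ p = q := by
  rw [pathIdem_eq_canonical, pathIdem_eq_canonical] at h
  obtain ⟨hv, -, hpq, -⟩ := T.canon_inj v v w w p p q q _ _ hp hp (Gs.id_mem _) rfl rfl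
    hq hq (Gs.id_mem _) rfl rfl h
  exact ⟨hv, hpq⟩

variable {T} in
/-- Every nonzero idempotent is of the form `pp*`. -/
theorem IsIdem.exists_eq_pathIdem {s : T.S} (hs : T.IsIdem s) (h0 : s ≠ T.zero) :
    ∃ v p, Γ.IsPathFrom v p ∧ s = T.pathIdem v p := by
  obtain ⟨v, w, p, q, g, hp, hq, hg, hdom, hcod, h⟩ := T.canon_ex s h0
  change s = T.mul (T.mul (T.P v p) (T.ιG g)) (T.star (T.P w q)) at h
  refine ⟨v, p, hp, ?_⟩
  have hgs : T.star (T.ιG g) = T.ιG g.symm := T.rel_star g _ hg g.isInverseArrow_symm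
  have hg' : g.symm ∈ Gs.carrier := Gs.inv_mem g _ hg g.isInverseArrow_symm
  have hgg : T.mul (T.ιG g) (T.star (T.ιG g)) = T.ιV (Γ.rng0 v p) := by
    rw [hgs, T.rel_comp g _ _ hg hg' g.isComposition_symm, T.rel_id, hcod]
  have hgd : T.mul (T.ιG g) (T.ιV (Γ.rng0 w q)) = T.ιG g := by
    rw [← T.rel_id, ← hdom]
    exact T.rel_comp g _ g hg (Gs.id_mem _) ⟨rfl, rfl, rfl, fun _ _ => rfl⟩
  calc s = T.mul s (T.star s) := by rw [hs.star_eq]; exact hs.symm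
    _ = T.mul (T.P v p) (T.mul (T.mul (T.mul (T.ιG g)
          (T.mul (T.star (T.P w q)) (T.P w q))) (T.star (T.ιG g))) (T.star (T.P v p))) := by
        rw [h]; simp only [T.star_mul, T.star_star, T.mul_assoc]
    _ = T.pathIdem v p := by
        rw [T.star_P_mul_P hq, hgd, hgg, ← T.mul_assoc, T.P_mul_ιV, pathIdem]

theorem pathIdem_mul_pathIdem_append {v : Γ.V} {p q : List Γ.E}
    (h : Γ.IsPathFrom v (p ++ q)) :
    T.mul (T.pathIdem v p) (T.pathIdem v (p ++ q)) = T.pathIdem v (p ++ q) := by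
  have hp : T.mul (T.mul (T.P v p) (T.star (T.P v p))) (T.P v p) = T.P v p := (T.inv_ax _).1
  rw [pathIdem, pathIdem, ← T.mul_assoc]
  congr 1
  rw [T.P_append h, ← T.mul_assoc, hp]

theorem pathIdem_append_mul_pathIdem {v : Γ.V} {p q : List Γ.E}
    (h : Γ.IsPathFrom v (p ++ q)) :
    T.mul (T.pathIdem v (p ++ q)) (T.pathIdem v p) = T.pathIdem v (p ++ q) := by
  have := congrArg T.star (T.pathIdem_mul_pathIdem_append h)
  rwa [T.star_mul, (T.isIdem_pathIdem v p).star_eq, (T.isIdem_pathIdem v (p ++ q)).star_eq] at this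

theorem pathIdem_mul_of_incomparable {v w : Γ.V} {p q : List Γ.E}
    (hp : Γ.IsPathFrom v p) (hq : Γ.IsPathFrom w q)
    (h : ¬ (v = w ∧ (p <+: q ∨ q <+: p))) :
    T.mul (T.pathIdem v p) (T.pathIdem w q) = T.zero := by
  rw [pathIdem, pathIdem, T.mul_assoc, ← T.mul_assoc (T.star (T.P v p)),
    T.star_P_mul_P_of_incomparable hp hq h, T.zero_mul, T.mul_zero]

/-- If no vertex emits exactly one edge, `pp*` and `pqq*p*` are separated by an idempotent
orthogonal to the second but not to the first, for every path `q` of positive length. -/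
theorem exists_isIdem_separating (hΓ : ∀ v : Γ.V, ¬ ∃! e : Γ.E, Γ.src e = v)
    {v : Γ.V} {p q : List Γ.E} (h : Γ.IsPathFrom v (p ++ q)) (hq : q ≠ []) :
    ∃ s, T.IsIdem s ∧ T.mul (T.pathIdem v p) s ≠ T.zero ∧
      T.mul (T.pathIdem v (p ++ q)) s = T.zero := by
  obtain ⟨e, r, rfl⟩ := List.exists_cons_of_ne_nil hq
  obtain ⟨hp, he, -⟩ := DirGraph.isPathFrom_append.1 h
  obtain ⟨f, hf, hfe⟩ : ∃ f, Γ.src f = Γ.rng0 v p ∧ f ≠ e := by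
    by_contra! hcon
    exact hΓ _ ⟨e, he, hcon⟩
  have hpf : Γ.IsPathFrom v (p ++ [f]) := DirGraph.isPathFrom_append.2 ⟨hp, hf, trivial⟩
  refine ⟨T.pathIdem v (p ++ [f]), T.isIdem_pathIdem _ _, ?_, ?_⟩
  · rw [T.pathIdem_mul_pathIdem_append hpf]
    exact T.pathIdem_ne_zero hpf
  · refine T.pathIdem_mul_of_incomparable h hpf ?_
    simp [List.prefix_append_right_inj, List.cons_prefix_cons, hfe, hfe.symm]

theorem zeroDisjunctive_of_not_existsUnique
    (hΓ : ∀ v : Γ.V, ¬ ∃! e : Γ.E, Γ.src e = v) : T.ZeroDisjunctive := by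
  intro e f he hf he0 hf0 hef
  obtain ⟨v, p, hp, rfl⟩ := he.exists_eq_pathIdem he0
  obtain ⟨w, q, hq, rfl⟩ := hf.exists_eq_pathIdem hf0
  by_cases hcomp : v = w ∧ (p <+: q ∨ q <+: p)
  · obtain ⟨rfl, ⟨r, rfl⟩ | ⟨r, rfl⟩⟩ := hcomp
    · have hr : r ≠ [] := by rintro rfl; simp at hef
      obtain ⟨s, hs, h₁, h₂⟩ := T.exists_isIdem_separating hΓ hq hr
      exact ⟨s, hs, Or.inr ⟨h₂, h₁⟩⟩
    · have hr : r ≠ [] := by rintro rfl; simp at hef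
      obtain ⟨s, hs, h₁, h₂⟩ := T.exists_isIdem_separating hΓ hp hr
      exact ⟨s, hs, Or.inl ⟨h₂, h₁⟩⟩
  · refine ⟨T.pathIdem w q, hf, Or.inl ⟨T.pathIdem_mul_of_incomparable hp hq hcomp, ?_⟩⟩
    rwa [show T.mul (T.pathIdem w q) (T.pathIdem w q) = T.pathIdem w q from hf]

/-- If `e` is the only edge emitted by `v`, then `v` and `ee*` are orthogonal to the same
idempotents. -/
theorem not_zeroDisjunctive_of_existsUnique {v : Γ.V} (hv : ∃! e : Γ.E, Γ.src e = v) :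
    ¬ T.ZeroDisjunctive := by
  obtain ⟨e, he, huniq⟩ := hv
  intro hT
  have hnil : Γ.IsPathFrom v [] := trivial
  have hpe : Γ.IsPathFrom v [e] := ⟨he, trivial⟩
  obtain ⟨s, hs, ⟨h₁, h₂⟩ | ⟨h₁, h₂⟩⟩ := hT _ _ (T.isIdem_pathIdem v [])
    (T.isIdem_pathIdem v [e]) (T.pathIdem_ne_zero hnil) (T.pathIdem_ne_zero hpe)
    (fun h => by simpa using (T.pathIdem_inj hnil hpe h).2)
  · refine h₂ ?_
    have hmul := T.pathIdem_append_mul_pathIdem (p := []) hpe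
    rw [List.nil_append] at hmul
    rw [← hmul, T.mul_assoc, h₁, T.mul_zero]
  · have hs0 : s ≠ T.zero := by
      rintro rfl
      exact h₂ (T.mul_zero _)
    obtain ⟨w, q, hq, rfl⟩ := hs.exists_eq_pathIdem hs0
    by_cases hvw : v = w
    · subst hvw
      cases q with
      | nil =>
        refine T.pathIdem_ne_zero hpe ?_
        rw [← h₁]
        exact (T.pathIdem_append_mul_pathIdem (p := []) hpe).symm
      | cons f q =>
        obtain rfl : f = e := huniq f hq.1
        refine hs0 ?_
        rw [← h₁]
        exact (T.pathIdem_mul_pathIdem_append (p := [f]) hq).symm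
    · exact h₂ (T.pathIdem_mul_of_incomparable hnil hq fun h => hvw h.1)

end AssocISG

/-- Theorem: the semilattice of idempotents `E_{(G,Γ*)}` is 0-disjunctive iff
`|s⁻¹(v)| ≠ 1` for all vertices `v`. -/
theorem statement4 (Γ : DirGraph) (Gs : SSG Γ) (T : AssocISG Γ Gs) :
    T.ZeroDisjunctive ↔ ∀ v : Γ.V, ¬ ∃! e : Γ.E, Γ.src e = v := by
  exact ⟨fun hT v hv => T.not_zeroDisjunctive_of_existsUnique hv hT,
    T.zeroDisjunctive_of_not_existsUnique⟩
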